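/- arXiv:1308.2034 — 2 statements merged into one kernel-verified Lean document; each statement's English description precedes it below -/
import Mathlib

section
/- Let A = K[X_1,…,X_n], ω ∈ Z_{≥0}^n a weight, F a free graded A-module with weighted basis, and M ⊆ F a graded submodule. Then M and its initial module in_{(ω,ε)}(M) have the same Hilbert function. -/
/-!  Basic setup: the polynomial ring `A = K[X_1,…,X_n]`, a graded free module
`F = ⊕_{j} A(-d_j)` realized as `Fin k → A`, weight orders `(ω, ε)`, initial
modules, Hilbert functions, graded free resolutions, Betti numbers,
regularity and componentwise notions, following Caviglia–Varbaro,
"Componentwise regularity (I)". -/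

namespace CregPaper

abbrev A (K : Type*) [Field K] (n : ℕ) := MvPolynomial (Fin n) K

variable {K : Type*} [Field K] {n k : ℕ}

/-- `(ω)`-weight of an exponent vector `u`. -/
def wdeg (ω : Fin n → ℕ) (u : Fin n →₀ ℕ) : ℕ := u.sum fun i e => ω i * e

/-- total (standard) degree of an exponent vector `u`. -/
def tdeg (u : Fin n →₀ ℕ) : ℕ := u.sum fun _ e => e

/-- largest `(ω,ε)`-weight of a monomial in the support of `f ∈ F`. -/
noncomputable def maxWt (ω : Fin n → ℕ) (ε : Fin k → ℕ) (f : Fin k → A K n) : ℕ :=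
  Finset.univ.sup fun j => (f j).support.sup fun u => wdeg ω u + ε j

/-- the initial part `in_{(ω,ε)}(f)`: the sum of the terms of `f` of largest weight. -/
noncomputable def inForm (ω : Fin n → ℕ) (ε : Fin k → ℕ) (f : Fin k → A K n) :
    Fin k → A K n :=
  fun j => ∑ u ∈ (f j).support.filter fun u => wdeg ω u + ε j = maxWt ω ε f,
    MvPolynomial.monomial u ((f j).coeff u)

/-- the initial module `in_{(ω,ε)}(M)`. -/
noncomputable def inMod (ω : Fin n → ℕ) (ε : Fin k → ℕ)
    (M : Submodule (A K n) (Fin k → A K n)) : Submodule (A K n) (Fin k → A K n) :=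
  Submodule.span (A K n) {g | ∃ f ∈ M, f ≠ 0 ∧ g = inForm ω ε f}

/-- `f ∈ F = ⊕_j A(-d_j)` is homogeneous of (standard) degree `a`. -/
def IsHomog (d : Fin k → ℕ) (a : ℕ) (f : Fin k → A K n) : Prop :=
  ∀ j, ∀ u ∈ (f j).support, tdeg u + d j = a

/-- the `K`-subspace of `F` of homogeneous elements of degree `a`. -/
noncomputable def homogSub (d : Fin k → ℕ) (a : ℕ) : Submodule K (Fin k → A K n) where
  carrier := {f | IsHomog d a f}
  add_mem' := by
    intro f g hf hg j u hu
    rcases Finset.mem_union.mp (MvPolynomial.support_add hu) with h | h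
    · exact hf j u h
    · exact hg j u h
  zero_mem' := by intro j u hu; simp at hu
  smul_mem' := by
    intro c f hf j u hu
    exact hf j u (MvPolynomial.support_smul hu)

/-- the degree-`a` homogeneous component of `f ∈ F`. -/
noncomputable def homogComp (d : Fin k → ℕ) (f : Fin k → A K n) (a : ℕ) : Fin k → A K n :=
  fun j => ∑ u ∈ (f j).support.filter fun u => tdeg u + d j = a,
    MvPolynomial.monomial u ((f j).coeff u)

/-- `M ⊆ F` is a graded submodule. -/
def IsGradedSub (d : Fin k → ℕ) (M : Submodule (A K n) (Fin k → A K n)) : Prop :=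
  ∀ f ∈ M, ∀ a, homogComp d f a ∈ M

/-- Hilbert function of `M ⊆ F` in degree `a`. -/
noncomputable def hilb (d : Fin k → ℕ) (M : Submodule (A K n) (Fin k → A K n)) (a : ℕ) : ℕ :=
  Module.finrank K ↥(Submodule.restrictScalars K M ⊓ homogSub d a)

/-- the homogeneous maximal ideal `m = (X_1,…,X_n)` of `A`. -/
noncomputable def mIdeal (K : Type*) [Field K] (n : ℕ) : Ideal (A K n) :=
  RingHom.ker (MvPolynomial.constantCoeff : A K n →+* K)

/-- graded Betti number `β_{0,a}(M) = dim_K (M/mM)_a`, the number of minimal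
generators of the graded module `M` in degree `a`. -/
noncomputable def beta0 (d : Fin k → ℕ) (M : Submodule (A K n) (Fin k → A K n)) (a : ℕ) : ℕ :=
  hilb d M a - hilb d (mIdeal K n • M) a

/-- A graded free resolution of a graded submodule `M` of `F = ⊕_j A(-d_j)`:
`⋯ → A^{rk 1} → A^{rk 0} → M → 0`, each free module coming with degree shifts
`sh i`, all maps graded of degree `0`. -/
structure GFRes (d : Fin k → ℕ) (M : Submodule (A K n) (Fin k → A K n)) where
  rk : ℕ → ℕ
  sh : (i : ℕ) → Fin (rk i) → ℕ
  aug : (Fin (rk 0) → A K n) →ₗ[A K n] (Fin k → A K n)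
  diff : (i : ℕ) → ((Fin (rk (i+1)) → A K n) →ₗ[A K n] (Fin (rk i) → A K n))
  aug_range : LinearMap.range aug = M
  aug_hom : ∀ l, IsHomog d (sh 0 l) (aug (Pi.single l 1))
  diff_hom : ∀ i l, IsHomog (sh i) (sh (i+1) l) (diff i (Pi.single l 1))
  ex0 : LinearMap.range (diff 0) = LinearMap.ker aug
  exs : ∀ i, LinearMap.range (diff (i+1)) = LinearMap.ker (diff i)

/-- minimality of a graded free resolution: all entries of the differential
matrices lie in the maximal ideal. -/
def GFRes.Minimal {d : Fin k → ℕ} {M : Submodule (A K n) (Fin k → A K n)}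
    (res : GFRes d M) : Prop :=
  ∀ i x l, res.diff i x l ∈ mIdeal K n

/-- the graded Betti number `β_{i,j}(M)` read off from a (minimal) resolution. -/
noncomputable def GFRes.betti {d : Fin k → ℕ} {M : Submodule (A K n) (Fin k → A K n)}
    (res : GFRes d M) (i j : ℕ) : ℕ :=
  (Finset.univ.filter fun l => res.sh i l = j).card

/-- `reg_A(M) ≤ r`: there is a minimal graded free resolution of `M` with
all shifts in homological degree `i` bounded by `i + r`. -/
def RegLE (d : Fin k → ℕ) (M : Submodule (A K n) (Fin k → A K n)) (r : ℕ) : Prop :=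
  ∃ res : GFRes d M, res.Minimal ∧ ∀ i l, res.sh i l ≤ i + r

/-- `M_{⟨a⟩}`: the submodule generated by the homogeneous elements of degree `a` of `M`. -/
noncomputable def compSub (d : Fin k → ℕ) (M : Submodule (A K n) (Fin k → A K n)) (a : ℕ) :
    Submodule (A K n) (Fin k → A K n) :=
  Submodule.span (A K n) {f | f ∈ M ∧ IsHomog d a f}

/-- `M` is `r`-componentwise regular: `reg (M_{⟨a⟩}) ≤ a + r` for all `a`. -/
def CWRegLE (d : Fin k → ℕ) (M : Submodule (A K n) (Fin k → A K n)) (r : ℕ) : Prop :=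
  ∀ a, RegLE d (compSub d M a) (a + r)

/-- `M` is componentwise linear: each `M_{⟨a⟩}` is zero or has regularity `a`. -/
def CompLinear (d : Fin k → ℕ) (M : Submodule (A K n) (Fin k → A K n)) : Prop :=
  ∀ a, compSub d M a = ⊥ ∨ RegLE d (compSub d M a) a

/-- `M` is generated in degrees `≤ a`. -/
def GenInDegLE (d : Fin k → ℕ) (M : Submodule (A K n) (Fin k → A K n)) (a : ℕ) : Prop :=
  M ≤ Submodule.span (A K n) {f | f ∈ M ∧ ∃ b ≤ a, IsHomog d b f}

end CregPaper

namespace CregPaper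

section Graded

variable {K : Type*} [Field K] {n k : ℕ}

lemma coeff_sum_filter_support (p : (Fin n →₀ ℕ) → Prop) [DecidablePred p] (f : A K n)
    (u : Fin n →₀ ℕ) :
    (∑ v ∈ f.support.filter p, MvPolynomial.monomial v (f.coeff v)).coeff u =
      if p u then f.coeff u else 0 := by
  simp only [MvPolynomial.coeff_sum, MvPolynomial.coeff_monomial, Finset.sum_ite_eq',
    Finset.mem_filter, MvPolynomial.mem_support_iff]
  grind

/-- The part of `f ∈ F` supported on the monomials `X^u e_j` with `wt j u = t`. -/
noncomputable def wtComp (wt : Fin k → (Fin n →₀ ℕ) → ℕ) (t : ℕ) :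
    (Fin k → A K n) →ₗ[K] (Fin k → A K n) where
  toFun f j := ∑ u ∈ (f j).support.filter fun u => wt j u = t,
    MvPolynomial.monomial u ((f j).coeff u)
  map_add' f g := by
    ext j u
    refine (coeff_sum_filter_support (fun u => wt j u = t) ((f + g) j) u).trans ?_
    simp only [Pi.add_apply, MvPolynomial.coeff_add, coeff_sum_filter_support]
    split_ifs <;> simp
  map_smul' c f := by
    ext j u
    refine (coeff_sum_filter_support (fun u => wt j u = t) ((c • f) j) u).trans ?_
    simp only [Pi.smul_apply, MvPolynomial.coeff_smul, coeff_sum_filter_support,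
      RingHom.id_apply]
    split_ifs <;> simp

lemma coeff_wtComp (wt : Fin k → (Fin n →₀ ℕ) → ℕ) (t : ℕ) (f : Fin k → A K n)
    (j : Fin k) (u : Fin n →₀ ℕ) :
    (wtComp wt t f j).coeff u = if wt j u = t then (f j).coeff u else 0 :=
  coeff_sum_filter_support (fun u => wt j u = t) (f j) u

/-- The elements of `F` all of whose monomials have weight `< t`. -/
noncomputable def wtLT (K : Type*) [Field K] (wt : Fin k → (Fin n →₀ ℕ) → ℕ) (t : ℕ) :
    Submodule K (Fin k → A K n) where
  carrier := {f | ∀ j u, (f j).coeff u ≠ 0 → wt j u < t}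
  add_mem' := by
    intro f g hf hg j u hu
    by_contra h
    refine hu ?_
    rw [Pi.add_apply, MvPolynomial.coeff_add, not_not.mp (mt (hf j u) h),
      not_not.mp (mt (hg j u) h), add_zero]
  zero_mem' := by intro j u hu; simp at hu
  smul_mem' := by
    intro c f hf j u hu
    refine hf j u fun h => hu ?_
    simp [h]

lemma mem_wtLT {wt : Fin k → (Fin n →₀ ℕ) → ℕ} {t : ℕ} {f : Fin k → A K n} :
    f ∈ wtLT K wt t ↔ ∀ j u, (f j).coeff u ≠ 0 → wt j u < t := Iff.rfl

lemma wtLT_zero (wt : Fin k → (Fin n →₀ ℕ) → ℕ) : wtLT K wt 0 = ⊥ := by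
  rw [eq_bot_iff]
  intro f hf
  rw [Submodule.mem_bot]
  ext j u
  by_contra h
  exact Nat.not_lt_zero _ (hf j u h)

lemma wtLT_succ_inf_ker (wt : Fin k → (Fin n →₀ ℕ) → ℕ) (t : ℕ) :
    wtLT K wt (t + 1) ⊓ LinearMap.ker (wtComp wt t) = wtLT K wt t := by
  ext f
  simp only [Submodule.mem_inf, mem_wtLT, LinearMap.mem_ker]
  constructor
  · rintro ⟨h, h0⟩ j u hu
    have h1 := coeff_wtComp wt t f j u
    rw [h0, Pi.zero_apply, MvPolynomial.coeff_zero] at h1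
    have := h j u hu
    grind
  · refine fun h => ⟨fun j u hu => Nat.lt_succ_of_lt (h j u hu), ?_⟩
    ext j u
    rw [coeff_wtComp, Pi.zero_apply, MvPolynomial.coeff_zero]
    have := h j u
    grind

lemma wtComp_mem_wtLT (wt : Fin k → (Fin n →₀ ℕ) → ℕ) (t : ℕ) (f : Fin k → A K n) :
    wtComp wt t f ∈ wtLT K wt (t + 1) := by
  intro j u hu
  rw [coeff_wtComp] at hu
  grind

lemma wtComp_mem_wtLT_of_mem (wt wt' : Fin k → (Fin n →₀ ℕ) → ℕ) (s t : ℕ)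
    {f : Fin k → A K n} (hf : f ∈ wtLT K wt t) : wtComp wt' s f ∈ wtLT K wt t := by
  intro j u hu
  rw [coeff_wtComp] at hu
  exact hf j u (by grind)

lemma wtComp_comm (wt wt' : Fin k → (Fin n →₀ ℕ) → ℕ) (s t : ℕ) (f : Fin k → A K n) :
    wtComp wt s (wtComp wt' t f) = wtComp wt' t (wtComp wt s f) := by
  ext j u
  simp only [coeff_wtComp]
  grind

lemma wtComp_wtComp (wt : Fin k → (Fin n →₀ ℕ) → ℕ) (s t : ℕ) (f : Fin k → A K n) :
    wtComp wt s (wtComp wt t f) = if s = t then wtComp wt t f else 0 := by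
  split_ifs with h
  all_goals
    ext j u
    simp only [coeff_wtComp, Pi.zero_apply, MvPolynomial.coeff_zero]
    grind

lemma mem_homogSub_iff {d : Fin k → ℕ} {a : ℕ} {f : Fin k → A K n} :
    f ∈ homogSub d a ↔ ∀ j u, (f j).coeff u ≠ 0 → tdeg u + d j = a := by
  change (∀ j, ∀ u ∈ (f j).support, tdeg u + d j = a) ↔ _
  simp only [MvPolynomial.mem_support_iff]

lemma wtComp_mem_homogSub (d : Fin k → ℕ) (a : ℕ) (f : Fin k → A K n) :
    wtComp (fun j u => tdeg u + d j) a f ∈ homogSub d a := by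
  rw [mem_homogSub_iff]
  intro j u hu
  rw [coeff_wtComp] at hu
  grind

lemma wtComp_mem_homogSub_of_mem (wt : Fin k → (Fin n →₀ ℕ) → ℕ) (t : ℕ) {d : Fin k → ℕ}
    {a : ℕ} {f : Fin k → A K n} (hf : f ∈ homogSub d a) : wtComp wt t f ∈ homogSub d a := by
  rw [mem_homogSub_iff] at hf ⊢
  intro j u hu
  rw [coeff_wtComp] at hu
  exact hf j u (by grind)

lemma wtComp_eq_self_of_mem_homogSub {d : Fin k → ℕ} {a : ℕ} {f : Fin k → A K n}
    (hf : f ∈ homogSub d a) : wtComp (fun j u => tdeg u + d j) a f = f := by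
  rw [mem_homogSub_iff] at hf
  ext j u
  rw [coeff_wtComp]
  have := hf j u
  grind

lemma wdeg_add (ω : Fin n → ℕ) (u v : Fin n →₀ ℕ) :
    wdeg ω (u + v) = wdeg ω u + wdeg ω v :=
  Finsupp.sum_add_index' (fun _ => mul_zero _) fun _ _ _ => mul_add _ _ _

lemma wdeg_le (ω : Fin n → ℕ) (u : Fin n →₀ ℕ) : wdeg ω u ≤ (∑ i, ω i) * tdeg u := by
  rw [wdeg, tdeg, Finsupp.sum, Finsupp.sum, Finset.mul_sum]
  exact Finset.sum_le_sum fun i _ =>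
    Nat.mul_le_mul_right _ (Finset.single_le_sum (fun _ _ => Nat.zero_le _) (Finset.mem_univ i))

lemma homogSub_le_wtLT (ω : Fin n → ℕ) (d ε : Fin k → ℕ) (a : ℕ) :
    homogSub d a ≤ wtLT K (fun j u => wdeg ω u + ε j) ((∑ i, ω i) * a + ∑ j, ε j + 1) := by
  intro f hf j u hu
  have h1 := mem_homogSub_iff.mp hf j u hu
  have h2 : ε j ≤ ∑ j, ε j := Finset.single_le_sum (fun _ _ => Nat.zero_le _) (Finset.mem_univ j)
  have h3 := (wdeg_le ω u).trans (Nat.mul_le_mul_left (∑ i, ω i) (show tdeg u ≤ a by omega))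
  dsimp only
  omega

/-- Rank–nullity for the leading part in weight `t`. -/
lemma rank_inf_wtLT_succ (wt : Fin k → (Fin n →₀ ℕ) → ℕ) (V : Submodule K (Fin k → A K n))
    (t : ℕ) :
    Module.rank K ↥(V ⊓ wtLT K wt (t + 1)) =
      Module.rank K ↥((V ⊓ wtLT K wt (t + 1)).map (wtComp wt t)) +
        Module.rank K ↥(V ⊓ wtLT K wt t) := by
  have h := LinearMap.rank_range_add_rank_ker
    ((wtComp wt t).domRestrict (V ⊓ wtLT K wt (t + 1)))
  rw [LinearMap.range_domRestrict, LinearMap.ker_domRestrict] at h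
  rw [← h]
  congr 1
  rw [LinearEquiv.rank_eq (Submodule.equivSubtypeMap _ _), Submodule.map_comap_subtype,
    inf_assoc, wtLT_succ_inf_ker]

/-- Two bounded subspaces of `F` with the same leading parts in each weight have the same rank. -/
lemma rank_eq_of_map_wtComp_eq (wt : Fin k → (Fin n →₀ ℕ) → ℕ)
    {V W : Submodule K (Fin k → A K n)} {T : ℕ} (hV : V ≤ wtLT K wt T) (hW : W ≤ wtLT K wt T)
    (h : ∀ t, (V ⊓ wtLT K wt (t + 1)).map (wtComp wt t) =
      (W ⊓ wtLT K wt (t + 1)).map (wtComp wt t)) :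
    Module.rank K V = Module.rank K W := by
  have key : ∀ t, Module.rank K ↥(V ⊓ wtLT K wt t) = Module.rank K ↥(W ⊓ wtLT K wt t) := by
    intro t
    induction t with
    | zero => rw [wtLT_zero, inf_bot_eq, inf_bot_eq]
    | succ t ih => rw [rank_inf_wtLT_succ, rank_inf_wtLT_succ, h, ih]
  have := key T
  rwa [inf_eq_left.mpr hV, inf_eq_left.mpr hW] at this

lemma le_maxWt (ω : Fin n → ℕ) (ε : Fin k → ℕ) {f : Fin k → A K n} {j : Fin k}
    {u : Fin n →₀ ℕ} (h : (f j).coeff u ≠ 0) : wdeg ω u + ε j ≤ maxWt ω ε f :=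
  (Finset.le_sup (f := fun u => wdeg ω u + ε j) (MvPolynomial.mem_support_iff.mpr h)).trans
    (Finset.le_sup (f := fun j => (f j).support.sup fun u => wdeg ω u + ε j) (Finset.mem_univ j))

lemma inForm_eq_wtComp (ω : Fin n → ℕ) (ε : Fin k → ℕ) (f : Fin k → A K n) :
    inForm ω ε f = wtComp (fun j u => wdeg ω u + ε j) (maxWt ω ε f) f := rfl

lemma wtComp_mem_inMod {ω : Fin n → ℕ} {ε : Fin k → ℕ}
    {M : Submodule (A K n) (Fin k → A K n)} {t : ℕ} {f : Fin k → A K n} (hf : f ∈ M)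
    (hft : f ∈ wtLT K (fun j u => wdeg ω u + ε j) (t + 1)) :
    wtComp (fun j u => wdeg ω u + ε j) t f ∈ inMod ω ε M := by
  by_cases h0 : wtComp (fun j u => wdeg ω u + ε j) t f = 0
  · rw [h0]; exact zero_mem _
  · have hne : f ≠ 0 := by
      rintro rfl
      exact h0 (map_zero _)
    have hmax : maxWt ω ε f = t := by
      refine le_antisymm ?_ ?_
      · refine Finset.sup_le fun j _ => Finset.sup_le fun u hu => ?_
        exact Nat.lt_succ_iff.mp (hft j u (MvPolynomial.mem_support_iff.mp hu))
      · by_contra hlt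
        refine h0 ?_
        ext j u
        rw [coeff_wtComp, Pi.zero_apply, MvPolynomial.coeff_zero]
        have := le_maxWt ω ε (f := f) (j := j) (u := u)
        grind
    exact Submodule.subset_span ⟨f, hf, hne, by rw [inForm_eq_wtComp, hmax]⟩

lemma monomial_smul_wtComp (ω : Fin n → ℕ) (ε : Fin k → ℕ) (t : ℕ) (f : Fin k → A K n)
    (v : Fin n →₀ ℕ) (c : K) :
    (MvPolynomial.monomial v c : A K n) • wtComp (fun j u => wdeg ω u + ε j) t f =
      wtComp (fun j u => wdeg ω u + ε j) (wdeg ω v + t)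
        ((MvPolynomial.monomial v c : A K n) • f) := by
  ext j u
  simp only [coeff_wtComp, Pi.smul_apply, smul_eq_mul, MvPolynomial.coeff_monomial_mul']
  by_cases h : v ≤ u
  · have := wdeg_add ω v (u - v)
    rw [add_tsub_cancel_of_le h] at this
    simp only [h, if_true]
    grind
  · simp [h]

lemma monomial_smul_mem_wtLT (ω : Fin n → ℕ) (ε : Fin k → ℕ) {t : ℕ} {f : Fin k → A K n}
    (hf : f ∈ wtLT K (fun j u => wdeg ω u + ε j) t) (v : Fin n →₀ ℕ) (c : K) :
    (MvPolynomial.monomial v c : A K n) • f ∈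
      wtLT K (fun j u => wdeg ω u + ε j) (wdeg ω v + t) := by
  intro j u hu
  simp only [Pi.smul_apply, smul_eq_mul, MvPolynomial.coeff_monomial_mul'] at hu
  by_cases h : v ≤ u
  · have h1 := wdeg_add ω v (u - v)
    rw [add_tsub_cancel_of_le h] at h1
    simp only [h, if_true] at hu
    have h2 := hf j (u - v) (right_ne_zero_of_mul hu)
    dsimp only at h2 ⊢
    omega
  · simp [h] at hu

/-- The initial module is spanned over `K` by the leading parts of elements of `M`. -/
lemma inMod_le_span (ω : Fin n → ℕ) (ε : Fin k → ℕ) (M : Submodule (A K n) (Fin k → A K n))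
    {g : Fin k → A K n} (hg : g ∈ inMod ω ε M) :
    g ∈ Submodule.span K {x | ∃ t, ∃ f ∈ M, f ∈ wtLT K (fun j u => wdeg ω u + ε j) (t + 1) ∧
      x = wtComp (fun j u => wdeg ω u + ε j) t f} := by
  induction hg using Submodule.span_induction with
  | mem x hx =>
    obtain ⟨f, hf, -, rfl⟩ := hx
    exact Submodule.subset_span ⟨maxWt ω ε f, f, hf,
      fun j u hu => Nat.lt_succ_of_le (le_maxWt ω ε hu), rfl⟩
  | zero => exact zero_mem _
  | add x y _ _ hx hy => exact add_mem hx hy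
  | smul p x hxM hx =>
    clear hxM
    induction p using MvPolynomial.induction_on' with
    | add p q hp hq => rw [add_smul]; exact add_mem hp hq
    | monomial v c =>
      induction hx using Submodule.span_induction with
      | mem x hx =>
        obtain ⟨t, f, hf, hft, rfl⟩ := hx
        exact Submodule.subset_span ⟨wdeg ω v + t, _, M.smul_mem _ hf,
          monomial_smul_mem_wtLT ω ε hft v c, monomial_smul_wtComp ω ε t f v c⟩
      | zero => rw [smul_zero]; exact zero_mem _
      | add x y _ _ hx hy => rw [smul_add]; exact add_mem hx hy
      | smul r x _ hx => rw [smul_comm]; exact Submodule.smul_mem _ _ hx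

lemma wtComp_mem_map_of_mem_inMod {ω : Fin n → ℕ} {d ε : Fin k → ℕ}
    {M : Submodule (A K n) (Fin k → A K n)} (hM : IsGradedSub d M) {g : Fin k → A K n}
    (hg : g ∈ inMod ω ε M) (a t : ℕ) :
    wtComp (fun j u => wdeg ω u + ε j) t (wtComp (fun j u => tdeg u + d j) a g) ∈
      ((Submodule.restrictScalars K M ⊓ homogSub d a) ⊓
        wtLT K (fun j u => wdeg ω u + ε j) (t + 1)).map
          (wtComp (fun j u => wdeg ω u + ε j) t) := by
  have hg' := inMod_le_span ω ε M hg
  rw [← LinearMap.comp_apply, ← Submodule.mem_comap]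
  refine Submodule.span_le.mpr ?_ hg'
  rintro _ ⟨s, f, hf, hfs, rfl⟩
  rw [SetLike.mem_coe, Submodule.mem_comap, LinearMap.comp_apply, wtComp_comm _ _ a s,
    wtComp_wtComp]
  split_ifs with hts
  · subst hts
    exact Submodule.mem_map_of_mem ⟨⟨hM f hf a, wtComp_mem_homogSub d a f⟩,
      wtComp_mem_wtLT_of_mem _ _ _ _ hfs⟩
  · exact zero_mem _

end Graded

/-- A graded submodule `M ⊆ F` and its initial module
`in_{(ω,ε)}(M)` have the same Hilbert function. -/
theorem hilbert_function_of_initial_module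
    {K : Type*} [Field K] {n k : ℕ} (ω : Fin n → ℕ) (d ε : Fin k → ℕ)
    (M : Submodule (A K n) (Fin k → A K n)) (hM : IsGradedSub d M) (a : ℕ) :
    hilb d M a = hilb d (inMod ω ε M) a := by
  have hT := homogSub_le_wtLT (K := K) ω d ε a
  refine congrArg Cardinal.toNat
    (rank_eq_of_map_wtComp_eq _ (inf_le_right.trans hT) (inf_le_right.trans hT) fun t => ?_)
  apply le_antisymm
  · rintro _ ⟨f, ⟨⟨hfM, hfa⟩, hft⟩, rfl⟩
    refine ⟨_, ⟨⟨wtComp_mem_inMod hfM hft, wtComp_mem_homogSub_of_mem _ t hfa⟩,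
      wtComp_mem_wtLT _ t f⟩, ?_⟩
    rw [wtComp_wtComp, if_pos rfl]
  · rintro _ ⟨g, ⟨⟨hgN, hga⟩, -⟩, rfl⟩
    have := wtComp_mem_map_of_mem_inMod hM hgN a t
    rwa [wtComp_eq_self_of_mem_homogSub hga] at this

end CregPaper
end

section
/- Let R be a Koszul standard graded K-algebra and M a finitely generated graded R-module generated in degrees ≤ d. Then reg_R(M) ≤ d + creg(M), where creg(M) is the componentwise regularity of M. -/
/-!  Setup for statements about componentwise regularity over a standard graded
`K`-algebra `R` with grading `𝒜 : ℤ → Submodule K R`: graded modules, graded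
free resolutions, Castelnuovo–Mumford regularity bounds, Koszulness and
componentwise notions. -/

namespace CregPaperG

variable {K : Type*} [Field K] {R : Type*} [CommRing R] [Algebra K R]

/-- `R` with grading `𝒜` is a standard graded `K`-algebra:
nothing in negative degrees, `R_0 = K·1`, and `R` generated in degree `1`. -/
def IsStdGraded (𝒜 : ℤ → Submodule K R) : Prop :=
  (∀ i : ℤ, i < 0 → 𝒜 i = ⊥) ∧ 𝒜 0 = 1 ∧
    ∀ i : ℕ, 𝒜 ((i : ℤ) + 1) = 𝒜 1 * 𝒜 (i : ℤ)

/-- the homogeneous maximal ideal `m = ⊕_{i>0} 𝒜_i` of `R`. -/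
def mIdealG (𝒜 : ℤ → Submodule K R) : Ideal R :=
  Ideal.span (⋃ i : {i : ℤ // i ≠ 0}, (𝒜 i.1 : Set R))

/-- A graded free resolution `⋯ → R^{rk 1} → R^{rk 0} → N → 0` of a submodule
`N` of a graded `R`-module `(M, ℳ)`, with degree shifts `sh i` and all maps
graded of degree `0`. -/
structure GRes (𝒜 : ℤ → Submodule K R) {M : Type*} [AddCommGroup M] [Module R M]
    [Module K M] [IsScalarTower K R M] (ℳ : ℤ → Submodule K M) (N : Submodule R M) where
  rk : ℕ → ℕ
  sh : (i : ℕ) → Fin (rk i) → ℤ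
  aug : (Fin (rk 0) → R) →ₗ[R] M
  diff : (i : ℕ) → ((Fin (rk (i+1)) → R) →ₗ[R] (Fin (rk i) → R))
  aug_range : LinearMap.range aug = N
  aug_hom : ∀ l, aug (Pi.single l 1) ∈ ℳ (sh 0 l)
  diff_hom : ∀ i l v, diff i (Pi.single l 1) v ∈ 𝒜 (sh (i+1) l - sh i v)
  ex0 : LinearMap.range (diff 0) = LinearMap.ker aug
  exs : ∀ i, LinearMap.range (diff (i+1)) = LinearMap.ker (diff i)

/-- minimality: the entries of all differential matrices lie in `m`. -/
def GRes.Minimal {𝒜 : ℤ → Submodule K R} {M : Type*} [AddCommGroup M] [Module R M]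
    [Module K M] [IsScalarTower K R M] {ℳ : ℤ → Submodule K M} {N : Submodule R M}
    (res : GRes 𝒜 ℳ N) : Prop :=
  ∀ i x l, res.diff i x l ∈ mIdealG 𝒜

/-- `reg_R(N) ≤ r`: there is a minimal graded free resolution of `N` with all
shifts in homological degree `i` bounded by `i + r`. -/
def GRegLE (𝒜 : ℤ → Submodule K R) {M : Type*} [AddCommGroup M] [Module R M]
    [Module K M] [IsScalarTower K R M] (ℳ : ℤ → Submodule K M) (N : Submodule R M)
    (r : ℤ) : Prop :=
  ∃ res : GRes 𝒜 ℳ N, res.Minimal ∧ ∀ i l, res.sh i l ≤ (i : ℤ) + r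

/-- `R` is Koszul: the residue field `K = R/m` has a linear minimal graded free
resolution; equivalently, the maximal ideal `m` (as a graded submodule of `R`)
has a minimal graded free resolution with `i`-th shifts all equal to `i + 1`. -/
def Koszul (𝒜 : ℤ → Submodule K R) : Prop :=
  ∃ res : GRes 𝒜 𝒜 (mIdealG 𝒜), res.Minimal ∧ ∀ i l, res.sh i l = (i : ℤ) + 1

/-- `M_{⟨a⟩}`: the `R`-submodule generated by the degree-`a` component. -/
def gcomp {M : Type*} [AddCommGroup M] [Module R M] [Module K M]
    [IsScalarTower K R M] (ℳ : ℤ → Submodule K M) (a : ℤ) : Submodule R M :=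
  Submodule.span R (ℳ a : Set M)

/-- the degree-`a` component of the graded free module `⊕_v R(-s_v)`. -/
def freeGrade (𝒜 : ℤ → Submodule K R) {k : ℕ} (s : Fin k → ℤ) (a : ℤ) :
    Submodule K (Fin k → R) where
  carrier := {f | ∀ v, f v ∈ 𝒜 (a - s v)}
  add_mem' := by intro f g hf hg v; exact (𝒜 _).add_mem (hf v) (hg v)
  zero_mem' := by intro v; exact (𝒜 _).zero_mem
  smul_mem' := by intro c f hf v; exact (𝒜 _).smul_mem c (hf v)

/-- componentwise linearity of a submodule `N` of the graded free module
`⊕_v R(-s_v)`: for every `a`, the submodule generated by the degree-`a`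
elements of `N` is zero or has regularity `a`. -/
def GCompLinear (𝒜 : ℤ → Submodule K R) {k : ℕ} (s : Fin k → ℤ)
    (N : Submodule R (Fin k → R)) : Prop :=
  ∀ a : ℤ,
    Submodule.span R ((freeGrade 𝒜 s a : Set (Fin k → R)) ∩ N) = ⊥ ∨
    GRegLE 𝒜 (freeGrade 𝒜 s)
      (Submodule.span R ((freeGrade 𝒜 s a : Set (Fin k → R)) ∩ N)) a

end CregPaperG

namespace CregPaperG

section Regularity

open DirectSum

variable {K : Type*} [Field K] {R : Type*} [CommRing R] [Algebra K R]

/-- The degree-`i` component of a ring element. -/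
def ringComp (𝒜 : ℤ → Submodule K R) [GradedAlgebra 𝒜] (i : ℤ) (r : R) : R :=
  (decompose 𝒜 r i : R)

/-- `ℳ` grades the `R`-module `M`, possibly without exhausting it: multiplication is
homogeneous and there are projections onto the graded pieces. -/
structure IsGradedFamily (𝒜 : ℤ → Submodule K R) {M : Type*} [AddCommGroup M] [Module R M]
    (ℳ : ℤ → AddSubgroup M) : Prop where
  smul_mem : ∀ {i j : ℤ} {r : R} {x : M}, r ∈ 𝒜 i → x ∈ ℳ j → r • x ∈ ℳ (i + j)
  exists_proj : ∀ j, ∃ p : M →+ M, (∀ x ∈ ℳ j, p x = x) ∧ ∀ i, i ≠ j → ∀ x ∈ ℳ i, p x = 0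

/-- The degree-`j` component of the graded free module `⊕_v R(-d_v)`. -/
def homog (𝒜 : ℤ → Submodule K R) {ι : Type*} (d : ι → ℤ) (j : ℤ) : AddSubgroup (ι → R) where
  carrier := {f | ∀ v, f v ∈ 𝒜 (j - d v)}
  add_mem' := fun hf hg v => (𝒜 _).add_mem (hf v) (hg v)
  zero_mem' := fun _ => (𝒜 _).zero_mem
  neg_mem' := fun hf v => (𝒜 _).neg_mem (hf v)

/-- The submodule `Z` of `⊕_v R(-d_v)` has a graded free resolution up to homological degree
`n - 1` whose shifts in degree `i` are at most `i + s`. -/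
def HasBoundedRes (𝒜 : ℤ → Submodule K R) :
    ℕ → ∀ {ι : Type} [Fintype ι], (ι → ℤ) → Submodule R (ι → R) → ℤ → Prop
  | 0, _, _, _, _, _ => True
  | n + 1, ι, _, d, Z, s => ∃ (κ : Type) (_ : Fintype κ) (e : κ → ℤ) (z : κ → ι → R),
      (∀ k, e k ≤ s) ∧ (∀ k, z k ∈ homog 𝒜 d (e k)) ∧ Submodule.span R (Set.range z) = Z ∧
      HasBoundedRes 𝒜 n e (LinearMap.ker (Fintype.linearCombination R z)) (s + 1)

/-- `N` is covered by a graded free module with shifts at most `s` whose kernel has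
bounded resolutions of every length. -/
def HasBoundedCover (𝒜 : ℤ → Submodule K R) {M : Type*} [AddCommGroup M] [Module R M]
    (ℳ : ℤ → AddSubgroup M) (N : Submodule R M) (s : ℤ) : Prop :=
  ∃ (ι : Type) (_ : Fintype ι) (d : ι → ℤ) (x : ι → M),
    (∀ v, d v ≤ s) ∧ (∀ v, x v ∈ ℳ (d v)) ∧ Submodule.span R (Set.range x) = N ∧
    ∀ n, HasBoundedRes 𝒜 n d (LinearMap.ker (Fintype.linearCombination R x)) (s + 1)

section GradedFamily

variable {𝒜 : ℤ → Submodule K R} [GradedAlgebra 𝒜]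

theorem ringComp_mem (i : ℤ) (r : R) : ringComp 𝒜 i r ∈ 𝒜 i := (decompose 𝒜 r i).2

theorem ringComp_add (i : ℤ) (r t : R) :
    ringComp 𝒜 i (r + t) = ringComp 𝒜 i r + ringComp 𝒜 i t := by
  simp [ringComp, decompose_add]

theorem ringComp_of_mem {i : ℤ} {r : R} (h : r ∈ 𝒜 i) : ringComp 𝒜 i r = r :=
  decompose_of_mem_same 𝒜 h

theorem ringComp_of_ne {i j : ℤ} {r : R} (h : r ∈ 𝒜 i) (hij : i ≠ j) : ringComp 𝒜 j r = 0 :=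
  decompose_of_mem_ne 𝒜 h hij

theorem proj_smul {M : Type*} [AddCommGroup M] [Module R M] {ℳ : ℤ → AddSubgroup M}
    (h : IsGradedFamily 𝒜 ℳ) {j : ℤ} {p : M →+ M} (hp : ∀ x ∈ ℳ j, p x = x)
    (hp' : ∀ i, i ≠ j → ∀ x ∈ ℳ i, p x = 0) {c : ℤ} {x : M} (hx : x ∈ ℳ c) (r : R) :
    p (r • x) = ringComp 𝒜 (j - c) r • x := by
  induction r using Decomposition.inductionOn 𝒜 with
  | zero => simp [ringComp]
  | homogeneous m =>
    rename_i i
    by_cases hij : i = j - c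
    · subst hij
      rw [ringComp_of_mem m.2]
      refine hp _ ?_
      simpa using h.smul_mem m.2 hx
    · rw [ringComp_of_ne m.2 hij, zero_smul]
      exact hp' (i + c) (by omega) _ (h.smul_mem m.2 hx)
  | add a b ha hb => rw [add_smul, map_add, ha, hb, ringComp_add, add_smul]

theorem isGradedFamily_homog {ι : Type*} (d : ι → ℤ) : IsGradedFamily 𝒜 (homog 𝒜 d) where
  smul_mem := by
    intro i j r x hr hx v
    have := SetLike.mul_mem_graded hr (hx v)
    rwa [← add_sub_assoc] at this
  exists_proj j := by
    refine ⟨{ toFun := fun u v => ringComp 𝒜 (j - d v) (u v)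
              map_zero' := by ext v; simp [ringComp]
              map_add' := fun u w => by ext v; simp [ringComp_add] }, ?_, ?_⟩
    · intro x hx
      ext v
      exact ringComp_of_mem (hx v)
    · intro i hij x hx
      ext v
      exact ringComp_of_ne (hx v) (by omega)

/-- The homogeneous component of degree `j` of a coefficient vector. -/
def coeffComp (𝒜 : ℤ → Submodule K R) [GradedAlgebra 𝒜] {ι : Type*} (d : ι → ℤ) (j : ℤ)
    (u : ι → R) : ι → R := fun v => ringComp 𝒜 (j - d v) (u v)

theorem coeffComp_mem {ι : Type*} (d : ι → ℤ) (j : ℤ) (u : ι → R) :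
    coeffComp 𝒜 d j u ∈ homog 𝒜 d j := fun _ => ringComp_mem _ _

variable {M : Type*} [AddCommGroup M] [Module R M] {ℳ : ℤ → AddSubgroup M}

theorem proj_linearCombination (h : IsGradedFamily 𝒜 ℳ) {j : ℤ} {p : M →+ M}
    (hp : ∀ x ∈ ℳ j, p x = x) (hp' : ∀ i, i ≠ j → ∀ x ∈ ℳ i, p x = 0)
    {ι : Type*} [Fintype ι] {d : ι → ℤ} {x : ι → M} (hx : ∀ v, x v ∈ ℳ (d v)) (u : ι → R) :
    p (Fintype.linearCombination R x u) =
      Fintype.linearCombination R x (coeffComp 𝒜 d j u) := by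
  simp only [Fintype.linearCombination_apply, map_sum, coeffComp]
  exact Finset.sum_congr rfl fun v _ => proj_smul h hp hp' (hx v) _

theorem exists_homog_of_mem_span (h : IsGradedFamily 𝒜 ℳ) {ι : Type*} [Fintype ι] {d : ι → ℤ}
    {x : ι → M} (hx : ∀ v, x v ∈ ℳ (d v)) {j : ℤ} {a : M} (ha : a ∈ ℳ j)
    (hs : a ∈ Submodule.span R (Set.range x)) :
    ∃ u ∈ homog 𝒜 d j, Fintype.linearCombination R x u = a := by
  rw [← Fintype.range_linearCombination] at hs
  obtain ⟨u, rfl⟩ := hs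
  obtain ⟨p, hp, hp'⟩ := h.exists_proj j
  refine ⟨coeffComp 𝒜 d j u, coeffComp_mem d j u, ?_⟩
  rw [← proj_linearCombination h hp hp' hx, hp _ ha]

omit [GradedAlgebra 𝒜] in
theorem linearCombination_mem (h : IsGradedFamily 𝒜 ℳ) {ι : Type*} [Fintype ι] {d : ι → ℤ}
    {x : ι → M} (hx : ∀ v, x v ∈ ℳ (d v)) {j : ℤ} {u : ι → R} (hu : u ∈ homog 𝒜 d j) :
    Fintype.linearCombination R x u ∈ ℳ j := by
  rw [Fintype.linearCombination_apply]
  refine AddSubgroup.sum_mem _ fun v _ => ?_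
  simpa using h.smul_mem (hu v) (hx v)

theorem map_linearCombination {M' : Type*} [AddCommGroup M'] [Module R M'] (L : M →ₗ[R] M')
    {ι : Type*} [Fintype ι] (x : ι → M) (u : ι → R) :
    L (Fintype.linearCombination R x u) = Fintype.linearCombination R (fun v => L (x v)) u := by
  simp [Fintype.linearCombination_apply]

theorem linearCombination_mem_span {ι : Type*} [Fintype ι] (x : ι → M) (u : ι → R) :
    Fintype.linearCombination R x u ∈ Submodule.span R (Set.range x) := by
  rw [← Fintype.range_linearCombination]
  exact LinearMap.mem_range_self _ u

theorem single_mem_homog {ι : Type*} [DecidableEq ι] (d : ι → ℤ) (v : ι) :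
    (Pi.single v 1 : ι → R) ∈ homog 𝒜 d (d v) := by
  intro w
  by_cases hw : w = v
  · subst hw
    simpa using SetLike.GradedOne.one_mem (A := 𝒜)
  · simp [hw]

end GradedFamily

section BoundedRes

variable {𝒜 : ℤ → Submodule K R}

theorem hasBoundedRes_bot (n : ℕ) {ι : Type} [Fintype ι] (d : ι → ℤ) (s : ℤ) :
    HasBoundedRes 𝒜 n d (⊥ : Submodule R (ι → R)) s := by
  induction n generalizing ι s with
  | zero => trivial
  | succ n ih =>
    refine ⟨Empty, inferInstance, Empty.elim, Empty.elim, fun k => k.elim, fun k => k.elim,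
      by simp, ?_⟩
    rw [Subsingleton.elim (LinearMap.ker _) ⊥]
    exact ih _ _

theorem hasBoundedRes_top [GradedAlgebra 𝒜] (n : ℕ) {ι : Type} [Fintype ι] (d : ι → ℤ) {s : ℤ}
    (hd : ∀ v, d v ≤ s) : HasBoundedRes 𝒜 n d (⊤ : Submodule R (ι → R)) s := by
  classical
  cases n with
  | zero => trivial
  | succ n =>
    have hid : Fintype.linearCombination R (fun v => (Pi.single v 1 : ι → R)) =
        LinearMap.id := by
      ext v w
      simp
    refine ⟨ι, inferInstance, d, fun v => Pi.single v 1, hd, fun v => single_mem_homog d v, ?_, ?_⟩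
    · rw [← Fintype.range_linearCombination, hid, LinearMap.range_id]
    · rw [hid, LinearMap.ker_id]
      exact hasBoundedRes_bot _ _ _

theorem HasBoundedRes.shift {n : ℕ} {ι : Type} [Fintype ι] {d : ι → ℤ}
    {Z : Submodule R (ι → R)} {s : ℤ} (h : HasBoundedRes 𝒜 n d Z s) (a : ℤ) :
    HasBoundedRes 𝒜 n (fun v => d v + a) Z (s + a) := by
  induction n generalizing ι s with
  | zero => trivial
  | succ n ih =>
    obtain ⟨κ, _, e, z, he, hz, hspan, hk⟩ := h
    refine ⟨κ, inferInstance, fun k => e k + a, z, fun k => by linarith [he k], ?_, hspan, ?_⟩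
    · intro k v
      have := hz k v
      rwa [show e k + a - (d v + a) = e k - d v by ring]
    · rw [show s + a + 1 = s + 1 + a by ring]
      exact ih hk

theorem linearCombination_sumElim {M ι κ : Type*} [AddCommGroup M] [Module R M] [Fintype ι]
    [Fintype κ] (x : ι → M) (y : κ → M) (u : ι ⊕ κ → R) :
    Fintype.linearCombination R (Sum.elim x y) u =
      Fintype.linearCombination R x (u ∘ Sum.inl) +
        Fintype.linearCombination R y (u ∘ Sum.inr) := by
  simp [Fintype.linearCombination_apply]

theorem sumElim_mem_homog {ι κ : Type*} {d : ι → ℤ} {e : κ → ℤ} {j : ℤ} {u : ι → R} {w : κ → R}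
    (hu : u ∈ homog 𝒜 d j) (hw : w ∈ homog 𝒜 e j) :
    Sum.elim u w ∈ homog 𝒜 (Sum.elim d e) j := by
  rintro (v | v)
  · exact hu v
  · exact hw v

/-- Extension by zero along `Sum.inl`. -/
def extendInl (R : Type*) [CommRing R] (ι κ : Type*) : (ι → R) →ₗ[R] (ι ⊕ κ → R) where
  toFun u := Sum.elim u 0
  map_add' u w := by ext (v | v) <;> simp
  map_smul' c u := by ext (v | v) <;> simp

/-- A graded extension `0 → A → B → C → 0` of submodules of free modules, where `A → B` is
extension by zero. -/
structure IsGradedExt (𝒜 : ℤ → Submodule K R) {ι κ l : Type} (d : ι → ℤ) (e : κ → ℤ) (c : l → ℤ)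
    (A : Submodule R (ι → R)) (B : Submodule R (ι ⊕ κ → R)) (C : Submodule R (l → R))
    (g : (ι ⊕ κ → R) →ₗ[R] (l → R)) : Prop where
  inl_mem : ∀ u ∈ A, Sum.elim u 0 ∈ B
  map_inl : ∀ u ∈ A, g (Sum.elim u 0) = 0
  exists_inl : ∀ b ∈ B, g b = 0 → ∃ u ∈ A, Sum.elim u 0 = b
  map_mem : ∀ b ∈ B, g b ∈ C
  exists_lift : ∀ j, ∀ w ∈ C, w ∈ homog 𝒜 c j → ∃ b ∈ B, b ∈ homog 𝒜 (Sum.elim d e) j ∧ g b = w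

theorem HasBoundedRes.ext [GradedAlgebra 𝒜] {n : ℕ} {ι κ l : Type} [Fintype ι] [Fintype κ]
    [Fintype l] {d : ι → ℤ} {e : κ → ℤ} {c : l → ℤ}
    {A : Submodule R (ι → R)} {B : Submodule R (ι ⊕ κ → R)} {C : Submodule R (l → R)}
    {g : (ι ⊕ κ → R) →ₗ[R] (l → R)} (hg : IsGradedExt 𝒜 d e c A B C g) {s : ℤ}
    (hA : HasBoundedRes 𝒜 n d A s) (hC : HasBoundedRes 𝒜 n c C s) :
    HasBoundedRes 𝒜 n (Sum.elim d e) B s := by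
  induction n generalizing ι κ l s with
  | zero => trivial
  | succ n ih =>
    obtain ⟨α, _, a, x, ha, hx, rfl, hkx⟩ := hA
    obtain ⟨χ, _, f, z, hf, hz, rfl, hkz⟩ := hC
    choose b hbB hb hgb using
      fun k => hg.exists_lift (f k) (z k) (Submodule.subset_span ⟨k, rfl⟩) (hz k)
    have hgz : ∀ w, g (Fintype.linearCombination R b w) = Fintype.linearCombination R z w := by
      intro w
      rw [map_linearCombination]
      simp only [hgb]
    have hbmem : ∀ w, Fintype.linearCombination R b w ∈ B := fun w =>
      Submodule.span_le.2 (by rintro _ ⟨k, rfl⟩; exact hbB k) (linearCombination_mem_span b w)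
    have hinl : ∀ u, Fintype.linearCombination R
        (fun v => (Sum.elim (x v) 0 : ι ⊕ κ → R)) u =
          Sum.elim (Fintype.linearCombination R x u) 0 := by
      intro u
      have : Sum.elim (Fintype.linearCombination R x u) 0 =
        extendInl R ι κ (Fintype.linearCombination R x u) := rfl
      rw [this, map_linearCombination]
      rfl
    refine ⟨α ⊕ χ, inferInstance, Sum.elim a f, Sum.elim (fun v => Sum.elim (x v) 0) b,
      ?_, ?_, ?_, ?_⟩
    · rintro (v | v)
      · exact ha v
      · exact hf v
    · rintro (v | v)
      · exact sumElim_mem_homog (hx v) (zero_mem _)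
      · exact hb v
    · apply le_antisymm
      · rw [Submodule.span_le]
        rintro _ ⟨v | v, rfl⟩
        · exact hg.inl_mem _ (Submodule.subset_span ⟨v, rfl⟩)
        · exact hbB v
      · intro y hy
        have h1 := hg.map_mem y hy
        rw [← Fintype.range_linearCombination] at h1
        obtain ⟨w, hw⟩ := h1
        obtain ⟨u, hu, huy⟩ := hg.exists_inl (y - Fintype.linearCombination R b w)
          (B.sub_mem hy (hbmem w)) (by rw [map_sub, hgz, hw, sub_self])
        rw [← Fintype.range_linearCombination] at hu
        obtain ⟨t, rfl⟩ := hu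
        rw [← Fintype.range_linearCombination]
        refine ⟨Sum.elim t w, ?_⟩
        rw [linearCombination_sumElim]
        simp only [Sum.elim_comp_inl, Sum.elim_comp_inr, hinl, huy, sub_add_cancel]
    · refine ih (g := LinearMap.funLeft R R Sum.inr) (l := χ) (c := f) ?_ hkx hkz
      have key : ∀ y, y ∈ LinearMap.ker (Fintype.linearCombination R
          (Sum.elim (fun v => (Sum.elim (x v) 0 : ι ⊕ κ → R)) b)) ↔
          (Sum.elim (Fintype.linearCombination R x (y ∘ Sum.inl)) 0 : ι ⊕ κ → R) +
            Fintype.linearCombination R b (y ∘ Sum.inr) = 0 := by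
        intro y
        rw [LinearMap.mem_ker, linearCombination_sumElim, hinl]
      have hzero : (Sum.elim 0 0 : ι ⊕ κ → R) = 0 := by ext (v | v) <;> rfl
      constructor
      · intro u hu
        rw [LinearMap.mem_ker] at hu
        rw [key]
        simp [hu, hzero]
      · intro u hu
        ext v
        simp [LinearMap.funLeft_apply]
      · intro y hy h0
        have h0' : y ∘ Sum.inr = 0 := h0
        rw [key, h0', map_zero, add_zero] at hy
        refine ⟨y ∘ Sum.inl, ?_, ?_⟩
        · rw [LinearMap.mem_ker]
          ext v
          exact congrFun hy (Sum.inl v)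
        · rw [← h0']
          exact Sum.elim_comp_inl_inr y
      · intro y hy
        rw [key] at hy
        rw [LinearMap.mem_ker]
        have h2 := congrArg g hy
        rw [map_add, hgz, hg.map_inl _ (linearCombination_mem_span x _), map_zero,
          zero_add] at h2
        exact h2
      · intro j w hw hwj
        rw [LinearMap.mem_ker] at hw
        have hbw := linearCombination_mem (isGradedFamily_homog _) hb hwj
        obtain ⟨t, ht, hte⟩ := hg.exists_inl _ (hbmem w) (by rw [hgz, hw])
        have htj : t ∈ homog 𝒜 d j := by
          intro v
          have := hbw (Sum.inl v)
          rwa [← hte] at this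
        obtain ⟨u, huj, hu⟩ := exists_homog_of_mem_span (isGradedFamily_homog d) hx htj ht
        refine ⟨Sum.elim (-u) w, ?_, sumElim_mem_homog (neg_mem huj) hwj, ?_⟩
        · rw [key]
          simp only [Sum.elim_comp_inl, Sum.elim_comp_inr, map_neg, hu, ← hte]
          ext (v | v) <;> simp
        · exact Sum.elim_comp_inr (-u) w

theorem HasBoundedRes.ker_of_ker [GradedAlgebra 𝒜] {M : Type*} [AddCommGroup M] [Module R M]
    {ℳ : ℤ → AddSubgroup M} (hℳ : IsGradedFamily 𝒜 ℳ) {n : ℕ} {ι κ : Type} [Fintype ι] [Fintype κ]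
    {d : ι → ℤ} {e : κ → ℤ} {x : ι → M} {y : κ → M} {s : ℤ}
    (hd : ∀ v, d v ≤ s) (he : ∀ v, e v ≤ s)
    (hx : ∀ v, x v ∈ ℳ (d v)) (hy : ∀ v, y v ∈ ℳ (e v))
    (hxy : Submodule.span R (Set.range x) = Submodule.span R (Set.range y))
    (h : HasBoundedRes 𝒜 n d (LinearMap.ker (Fintype.linearCombination R x)) (s + 1)) :
    HasBoundedRes 𝒜 n e (LinearMap.ker (Fintype.linearCombination R y)) (s + 1) := by
  classical
  cases n with
  | zero => trivial
  | succ n =>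
    obtain ⟨γ, _, f, z, hf, hz, hspan, hk⟩ := h
    choose t htd ht using fun v => exists_homog_of_mem_span hℳ hy (hx v)
      (hxy ▸ Submodule.subset_span ⟨v, rfl⟩)
    choose t' htd' ht' using fun v => exists_homog_of_mem_span hℳ hx (hy v)
      (hxy.symm ▸ Submodule.subset_span ⟨v, rfl⟩)
    set θ := Fintype.linearCombination R t with hθ
    set θ' := Fintype.linearCombination R t' with hθ'
    set X := Fintype.linearCombination R x with hX
    set Y := Fintype.linearCombination R y with hY
    set Z := Fintype.linearCombination R z with hZ
    have hYθ : ∀ u, Y (θ u) = X u := by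
      intro u
      rw [hθ, map_linearCombination]
      simp only [ht, hX]
    have hXθ' : ∀ u, X (θ' u) = Y u := by
      intro u
      rw [hθ', map_linearCombination]
      simp only [ht', hY]
    have hZrange : ∀ u, X u = 0 ↔ ∃ p, Z p = u := by
      intro u
      rw [← LinearMap.mem_ker, ← hspan, ← Fintype.range_linearCombination, LinearMap.mem_range]
    have hXZ : ∀ p, X (Z p) = 0 := fun p => (hZrange _).2 ⟨p, rfl⟩
    set w : γ ⊕ κ → κ → R := Sum.elim (fun g => -θ (z g))
      (fun k => Pi.single k 1 - θ (t' k)) with hw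
    have hW : ∀ u, Fintype.linearCombination R w u =
        u ∘ Sum.inr - θ (Z (u ∘ Sum.inl) + θ' (u ∘ Sum.inr)) := by
      intro u
      rw [hw, linearCombination_sumElim]
      have h1 : Fintype.linearCombination R (fun g => -θ (z g)) (u ∘ Sum.inl) =
          -θ (Z (u ∘ Sum.inl)) := by
        rw [hZ, map_linearCombination]
        simp [Fintype.linearCombination_apply]
      have h2 : Fintype.linearCombination R (fun k => Pi.single k 1 - θ (t' k))
          (u ∘ Sum.inr) = u ∘ Sum.inr - θ (θ' (u ∘ Sum.inr)) := by
        have h3 : ∑ k, (u ∘ Sum.inr) k • (Pi.single k 1 : κ → R) = u ∘ Sum.inr := by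
          ext v
          simp [Finset.sum_apply, Pi.single_apply]
        rw [Fintype.linearCombination_apply]
        simp only [smul_sub, Finset.sum_sub_distrib]
        rw [h3, hθ', map_linearCombination, Fintype.linearCombination_apply]
      rw [h1, h2, map_add]
      abel
    refine ⟨γ ⊕ κ, inferInstance, Sum.elim f e, w, ?_, ?_, ?_, ?_⟩
    · rintro (v | v)
      · exact hf v
      · exact (he v).trans (by omega)
    · rintro (v | v)
      · exact neg_mem (linearCombination_mem (isGradedFamily_homog e) htd (hz v))
      · exact sub_mem (single_mem_homog e v)
          (linearCombination_mem (isGradedFamily_homog e) htd (htd' v))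
    · rw [← Fintype.range_linearCombination]
      ext q
      rw [LinearMap.mem_ker]
      constructor
      · rintro ⟨u, rfl⟩
        rw [hW, map_sub, hYθ, map_add, hXZ, hXθ', zero_add, sub_self]
      · intro hq
        obtain ⟨p, hp⟩ := (hZrange (θ' q)).1 (by rw [hXθ', hq])
        refine ⟨Sum.elim (-p) q, ?_⟩
        rw [hW]
        simp only [Sum.elim_comp_inl, Sum.elim_comp_inr, map_neg, hp, neg_add_cancel, map_zero,
          sub_zero]
    · have htop : HasBoundedRes 𝒜 n d (⊤ : Submodule R (ι → R)) (s + 1 + 1) :=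
        hasBoundedRes_top n d fun v => (hd v).trans (by omega)
      refine HasBoundedRes.ext (g := Z ∘ₗ LinearMap.funLeft R R Sum.inl +
        θ' ∘ₗ LinearMap.funLeft R R Sum.inr) ?_ hk htop
      have hg : ∀ u : γ ⊕ κ → R, (Z ∘ₗ LinearMap.funLeft R R Sum.inl +
        θ' ∘ₗ LinearMap.funLeft R R Sum.inr : (γ ⊕ κ → R) →ₗ[R] (ι → R)) u = Z (u ∘ Sum.inl) + θ' (u ∘ Sum.inr) :=
        fun u => rfl
      constructor
      · intro u hu
        rw [LinearMap.mem_ker] at hu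
        rw [LinearMap.mem_ker, hW]
        simp only [Sum.elim_comp_inl, Sum.elim_comp_inr, hu, map_zero, add_zero, sub_zero]
      · intro u hu
        rw [LinearMap.mem_ker] at hu
        rw [hg]
        simp only [Sum.elim_comp_inl, Sum.elim_comp_inr, hu, map_zero, add_zero]
      · intro b hb h0
        rw [hg] at h0
        rw [LinearMap.mem_ker, hW, h0, map_zero, sub_zero] at hb
        rw [hb, map_zero, add_zero] at h0
        exact ⟨b ∘ Sum.inl, h0, by rw [← hb]; exact Sum.elim_comp_inl_inr b⟩
      · intro b _
        trivial
      · intro j c _ hc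
        have hθc := linearCombination_mem (isGradedFamily_homog e) htd hc
        have hθθc := linearCombination_mem (isGradedFamily_homog d) htd' hθc
        obtain ⟨p, hpj, hp⟩ := exists_homog_of_mem_span (isGradedFamily_homog d) hz
          (sub_mem hc hθθc) (by
            rw [hspan, LinearMap.mem_ker, map_sub]
            exact sub_eq_zero.2 (by rw [hXθ', hYθ]))
        have hsum : Z p + θ' (θ c) = c := by
          rw [hZ, hp]
          exact sub_add_cancel _ _
        refine ⟨Sum.elim p (θ c), ?_, sumElim_mem_homog hpj hθc, ?_⟩
        · rw [LinearMap.mem_ker, hW]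
          simp only [Sum.elim_comp_inl, Sum.elim_comp_inr, hsum, sub_self]
        · rw [hg]
          simp only [Sum.elim_comp_inl, Sum.elim_comp_inr, hsum]

theorem HasBoundedRes.mono {n : ℕ} {ι : Type} [Fintype ι] {d : ι → ℤ}
    {Z : Submodule R (ι → R)} {s t : ℤ} (h : HasBoundedRes 𝒜 n d Z s) (hst : s ≤ t) :
    HasBoundedRes 𝒜 n d Z t := by
  induction n generalizing ι s t with
  | zero => trivial
  | succ n ih =>
    obtain ⟨κ, _, e, z, he, hz, hspan, hk⟩ := h
    exact ⟨κ, inferInstance, e, z, fun k => (he k).trans hst, hz, hspan,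
      ih hk (by omega)⟩

end BoundedRes

section Resolutions

variable {𝒜 : ℤ → Submodule K R} {M : Type*} [AddCommGroup M] [Module R M]

theorem linearCombination_single {ι : Type*} [Fintype ι] [DecidableEq ι] (φ : (ι → R) →ₗ[R] M) :
    Fintype.linearCombination R (fun l => φ (Pi.single l 1)) = φ := by
  ext l
  simp

variable [Module K M] [IsScalarTower K R M] {ℳ : ℤ → Submodule K M} {N : Submodule R M}

theorem GRes.hasBoundedRes (res : GRes 𝒜 ℳ N) {s : ℤ} (hs : ∀ i l, res.sh i l ≤ (i : ℤ) + s)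
    (n i : ℕ) : HasBoundedRes 𝒜 n (res.sh i) (LinearMap.range (res.diff i)) (i + s + 1) := by
  induction n generalizing i with
  | zero => trivial
  | succ n ih =>
    refine ⟨Fin (res.rk (i + 1)), inferInstance, res.sh (i + 1),
      fun l => res.diff i (Pi.single l 1), fun l => ?_, fun l v => res.diff_hom i l v, ?_, ?_⟩
    · have := hs (i + 1) l
      push_cast at this
      omega
    · rw [← Fintype.range_linearCombination, linearCombination_single]
    · rw [linearCombination_single, ← res.exs i]
      have := ih (i + 1)
      push_cast at this
      rwa [show (i : ℤ) + s + 1 = i + 1 + s by ring]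

theorem GRegLE.hasBoundedCover {s : ℤ} (h : GRegLE 𝒜 ℳ N s) :
    HasBoundedCover 𝒜 (fun j => (ℳ j).toAddSubgroup) N s := by
  obtain ⟨res, -, hs⟩ := h
  refine ⟨Fin (res.rk 0), inferInstance, res.sh 0, fun l => res.aug (Pi.single l 1), ?_,
    res.aug_hom, ?_, ?_⟩
  · intro l
    simpa using hs 0 l
  · rw [← Fintype.range_linearCombination, linearCombination_single, res.aug_range]
  · intro n
    rw [linearCombination_single, ← res.ex0]
    simpa using res.hasBoundedRes hs n 0

theorem Koszul.hasBoundedRes (h : Koszul 𝒜) (n : ℕ) (a : ℤ) :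
    HasBoundedRes 𝒜 n (fun _ : Unit => a)
      (Submodule.comap (LinearMap.proj ()) (mIdealG 𝒜)) (a + 1) := by
  obtain ⟨res, -, hs⟩ := h
  have main : HasBoundedRes 𝒜 n (fun _ : Unit => 0)
      (Submodule.comap (LinearMap.proj ()) (mIdealG 𝒜)) 1 := by
    cases n with
    | zero => trivial
    | succ n =>
      have hlin : ∀ u, Fintype.linearCombination R
          (fun l => (fun _ : Unit => res.aug (Pi.single l 1))) u = fun _ => res.aug u := by
        intro u
        conv_rhs => rw [← linearCombination_single res.aug]
        ext
        simp [Fintype.linearCombination_apply]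
      refine ⟨Fin (res.rk 0), inferInstance, res.sh 0,
        fun l _ => res.aug (Pi.single l 1), fun l => ?_, fun l _ => ?_, ?_, ?_⟩
      · simp [hs]
      · simpa using res.aug_hom l
      · rw [← Fintype.range_linearCombination]
        ext w
        refine Iff.trans ?_ (SetLike.ext_iff.1 res.aug_range (w ()))
        constructor
        · rintro ⟨u, rfl⟩
          rw [hlin]
          exact ⟨u, rfl⟩
        · rintro ⟨u, hu⟩
          refine ⟨u, ?_⟩
          rw [hlin]
          ext
          exact hu
      · have hker : LinearMap.ker (Fintype.linearCombination R
            (fun l => (fun _ : Unit => res.aug (Pi.single l 1)))) =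
              LinearMap.range (res.diff 0) := by
          rw [res.ex0]
          ext u
          rw [LinearMap.mem_ker, LinearMap.mem_ker, hlin]
          exact ⟨fun hu => congrFun hu (), fun hu => funext fun _ => hu⟩
        rw [hker]
        simpa using res.hasBoundedRes (s := 1) (fun i l => (hs i l).le) n 0
  have := main.shift a
  simp only [zero_add] at this
  rwa [add_comm a 1]

end Resolutions

section MaximalIdeal

variable {𝒜 : ℤ → Submodule K R} [GradedAlgebra 𝒜]

theorem sub_ringComp_zero_mem (r : R) : r - ringComp 𝒜 0 r ∈ mIdealG 𝒜 := by
  induction r using Decomposition.inductionOn 𝒜 with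
  | zero => simp [ringComp]
  | homogeneous m =>
    rename_i i
    by_cases hi : i = 0
    · subst hi
      simp [ringComp_of_mem m.2]
    · rw [ringComp_of_ne m.2 hi, sub_zero]
      exact Ideal.subset_span (Set.mem_iUnion.2 ⟨⟨i, hi⟩, m.2⟩)
  | add a b ha hb =>
    rw [ringComp_add, add_sub_add_comm]
    exact Ideal.add_mem _ ha hb

/-- An element outside the maximal ideal has an invertible scalar as degree-`0` part. -/
theorem exists_ringComp_zero_eq (hstd : IsStdGraded 𝒜) {r : R} (hr : r ∉ mIdealG 𝒜) :
    ∃ c : K, c ≠ 0 ∧ ringComp 𝒜 0 r = algebraMap K R c := by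
  have h0 : ringComp 𝒜 0 r ∈ 𝒜 0 := ringComp_mem 0 r
  rw [hstd.2.1, Submodule.mem_one] at h0
  obtain ⟨c, hc⟩ := h0
  refine ⟨c, ?_, hc.symm⟩
  rintro rfl
  apply hr
  have := sub_ringComp_zero_mem (𝒜 := 𝒜) r
  rwa [← hc, map_zero, sub_zero] at this

variable {M : Type*} [AddCommGroup M] [Module R M] {ℳ : ℤ → AddSubgroup M}

omit [GradedAlgebra 𝒜] in
theorem mem_of_algebraMap_smul_mem {N : Submodule R M} {c : K} (hc : c ≠ 0) {x : M}
    (h : algebraMap K R c • x ∈ N) : x ∈ N := by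
  have := N.smul_mem (algebraMap K R c⁻¹) h
  rwa [smul_smul, ← map_mul, inv_mul_cancel₀ hc, map_one, one_smul] at this

theorem exists_minimal_cover_fin (hstd : IsStdGraded 𝒜) (hℳ : IsGradedFamily 𝒜 ℳ) {s : ℤ} {k : ℕ}
    {d : Fin k → ℤ} {x : Fin k → M} (hd : ∀ v, d v ≤ s) (hx : ∀ v, x v ∈ ℳ (d v)) :
    ∃ (k : ℕ) (e : Fin k → ℤ) (y : Fin k → M), (∀ v, e v ≤ s) ∧ (∀ v, y v ∈ ℳ (e v)) ∧
      Submodule.span R (Set.range y) = Submodule.span R (Set.range x) ∧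
      ∀ u, Fintype.linearCombination R y u = 0 → ∀ v, u v ∈ mIdealG 𝒜 := by
  induction k with
  | zero => exact ⟨0, d, x, hd, hx, rfl, fun u _ v => v.elim0⟩
  | succ k ih =>
    by_cases hmin : ∀ u, Fintype.linearCombination R x u = 0 → ∀ v, u v ∈ mIdealG 𝒜
    · exact ⟨k + 1, d, x, hd, hx, rfl, hmin⟩
    push Not at hmin
    obtain ⟨u, hu, v, huv⟩ := hmin
    obtain ⟨c, hc, hcu⟩ := exists_ringComp_zero_eq hstd huv
    obtain ⟨p, hp, hp'⟩ := hℳ.exists_proj (d v)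
    have h0 := proj_linearCombination hℳ hp hp' hx u
    rw [hu, map_zero, Fintype.linearCombination_apply, Fin.sum_univ_succAbove _ v] at h0
    have hv : x v ∈ Submodule.span R (Set.range (x ∘ v.succAbove)) := by
      refine mem_of_algebraMap_smul_mem hc ?_
      have h1 : coeffComp 𝒜 d (d v) u v = algebraMap K R c := by
        rw [← hcu]
        simp [coeffComp]
      rw [h1] at h0
      rw [eq_neg_of_add_eq_zero_left h0.symm]
      exact neg_mem (Submodule.sum_mem _ fun i _ =>
        Submodule.smul_mem _ _ (Submodule.subset_span ⟨i, rfl⟩))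
    obtain ⟨m, e, y, he, hy, hspan, hm⟩ := ih (d := d ∘ v.succAbove) (x := x ∘ v.succAbove)
      (fun i => hd _) (fun i => hx _)
    refine ⟨m, e, y, he, hy, hspan.trans (le_antisymm ?_ ?_), hm⟩
    · exact Submodule.span_mono (Set.range_comp_subset_range _ _)
    · rw [Submodule.span_le]
      rintro _ ⟨i, rfl⟩
      obtain rfl | ⟨i, rfl⟩ := Fin.eq_self_or_eq_succAbove v i
      · exact hv
      · exact Submodule.subset_span ⟨i, rfl⟩

theorem exists_minimal_cover (hstd : IsStdGraded 𝒜) (hℳ : IsGradedFamily 𝒜 ℳ) {s : ℤ} {ι : Type*}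
    [Fintype ι] {d : ι → ℤ} {x : ι → M} (hd : ∀ v, d v ≤ s) (hx : ∀ v, x v ∈ ℳ (d v)) :
    ∃ (k : ℕ) (e : Fin k → ℤ) (y : Fin k → M), (∀ v, e v ≤ s) ∧ (∀ v, y v ∈ ℳ (e v)) ∧
      Submodule.span R (Set.range y) = Submodule.span R (Set.range x) ∧
      ∀ u, Fintype.linearCombination R y u = 0 → ∀ v, u v ∈ mIdealG 𝒜 := by
  have := exists_minimal_cover_fin hstd hℳ (d := d ∘ (Fintype.equivFin ι).symm)
    (x := x ∘ (Fintype.equivFin ι).symm) (fun _ => hd _) (fun _ => hx _)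
  rwa [(Fintype.equivFin ι).symm.surjective.range_comp] at this

theorem exists_minimal_cover_of_hasBoundedRes (hstd : IsStdGraded 𝒜) {ι : Type} [Fintype ι]
    {d : ι → ℤ} {Z : Submodule R (ι → R)} {s : ℤ} (h : ∀ n, HasBoundedRes 𝒜 n d Z s) :
    ∃ (k : ℕ) (e : Fin k → ℤ) (y : Fin k → ι → R), (∀ v, e v ≤ s) ∧
      (∀ v, y v ∈ homog 𝒜 d (e v)) ∧ Submodule.span R (Set.range y) = Z ∧
      (∀ u, Fintype.linearCombination R y u = 0 → ∀ v, u v ∈ mIdealG 𝒜) ∧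
      ∀ n, HasBoundedRes 𝒜 n e (LinearMap.ker (Fintype.linearCombination R y)) (s + 1) := by
  obtain ⟨κ, _, f, z, hf, hz, hspan, -⟩ := h 1
  obtain ⟨k, e, y, he, hy, hyz, hm⟩ := exists_minimal_cover hstd (isGradedFamily_homog d) hf hz
  refine ⟨k, e, y, he, hy, hyz.trans hspan, hm, fun n => ?_⟩
  obtain ⟨κ', _, f', z', hf', hz', hspan', hk'⟩ := h (n + 1)
  exact hk'.ker_of_ker (isGradedFamily_homog d) hf' he hz' hy
    (hspan'.trans (hspan.symm.trans hyz.symm))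

theorem HasBoundedCover.gregLE [Module K M] [IsScalarTower K R M] {𝒩 : ℤ → Submodule K M}
    (hstd : IsStdGraded 𝒜) (h𝒩 : IsGradedFamily 𝒜 fun j => (𝒩 j).toAddSubgroup)
    {N : Submodule R M} {s : ℤ}
    (h : HasBoundedCover 𝒜 (fun j => (𝒩 j).toAddSubgroup) N s) : GRegLE 𝒜 𝒩 N s := by
  obtain ⟨ι, _, d, x, hd, hx, hspan, hk⟩ := h
  obtain ⟨k₀, e₀, y₀, he₀, hy₀, hspan₀, hm₀⟩ := exists_minimal_cover hstd h𝒩 hd hx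
  have hk₀ : ∀ n, HasBoundedRes 𝒜 n e₀
      (LinearMap.ker (Fintype.linearCombination R y₀)) (s + 1) := fun n =>
    (hk n).ker_of_ker h𝒩 hd he₀ hx hy₀ hspan₀.symm
  let St : ℕ → Type _ := fun i => {p : Σ k : ℕ, (Fin k → ℤ) × Submodule R (Fin k → R) //
    ∀ n, HasBoundedRes 𝒜 n p.2.1 p.2.2 (s + 1 + i)}
  have step : ∀ i (S : St i), ∃ (k : ℕ) (e : Fin k → ℤ) (y : Fin k → Fin S.1.1 → R),
      (∀ v, e v ≤ s + 1 + i) ∧ (∀ v, y v ∈ homog 𝒜 S.1.2.1 (e v)) ∧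
      Submodule.span R (Set.range y) = S.1.2.2 ∧
      (∀ u, Fintype.linearCombination R y u = 0 → ∀ v, u v ∈ mIdealG 𝒜) ∧
      ∀ n, HasBoundedRes 𝒜 n e (LinearMap.ker (Fintype.linearCombination R y))
        (s + 1 + (i + 1 : ℕ)) := by
    intro i S
    obtain ⟨k, e, y, h1, h2, h3, h4, h5⟩ := exists_minimal_cover_of_hasBoundedRes hstd S.2
    refine ⟨k, e, y, h1, h2, h3, h4, fun n => ?_⟩
    push_cast
    rw [← add_assoc]
    exact h5 n
  choose k e y he hy hspan' hm hres using step
  let seq : ∀ i, St i := fun i => Nat.rec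
    (⟨⟨k₀, e₀, LinearMap.ker (Fintype.linearCombination R y₀)⟩, by simpa using hk₀⟩ : St 0)
    (fun i S => (⟨⟨k i S, e i S, LinearMap.ker (Fintype.linearCombination R (y i S))⟩,
      hres i S⟩ : St (i + 1))) i
  have hrange : ∀ i, LinearMap.range (Fintype.linearCombination R (y i (seq i))) =
      (seq i).1.2.2 := fun i => by rw [Fintype.range_linearCombination, hspan']
  refine ⟨{ rk := fun i => (seq i).1.1
            sh := fun i => (seq i).1.2.1
            aug := Fintype.linearCombination R y₀
            diff := fun i => Fintype.linearCombination R (y i (seq i))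
            aug_range := ?_
            aug_hom := ?_
            diff_hom := ?_
            ex0 := hrange 0
            exs := fun i => hrange (i + 1) }, ?_, ?_⟩
  · rw [Fintype.range_linearCombination, hspan₀, hspan]
  · intro l
    have := hy₀ l
    rw [Fintype.linearCombination_apply_single, one_smul]
    exact this
  · intro i l v
    rw [Fintype.linearCombination_apply_single, one_smul]
    exact hy i (seq i) l v
  · intro i u l
    have hmem : Fintype.linearCombination R (y i (seq i)) u ∈ (seq i).1.2.2 := by
      rw [← hrange]
      exact LinearMap.mem_range_self _ u
    cases i with
    | zero => exact hm₀ _ hmem l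
    | succ i => exact hm i (seq i) _ hmem l
  · intro i l
    cases i with
    | zero => exact (he₀ l).trans (by simp)
    | succ i =>
      have := he i (seq i) l
      push_cast
      exact this.trans (by omega)

theorem HasBoundedCover.sup_span (hℳ : IsGradedFamily 𝒜 ℳ) (hkos : Koszul 𝒜) {N : Submodule R M}
    {s a : ℤ} (hN : HasBoundedCover 𝒜 ℳ N s) {x₀ : M} (hx₀ : x₀ ∈ ℳ a) (ha : a ≤ s)
    (hm : ∀ r : R, r • x₀ ∈ N ↔ r ∈ mIdealG 𝒜) :
    HasBoundedCover 𝒜 ℳ (N ⊔ Submodule.span R {x₀}) s := by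
  obtain ⟨ι, _, d, x, hd, hx, rfl, hk⟩ := hN
  have hlin : ∀ b : ι ⊕ Unit → R, Fintype.linearCombination R (Sum.elim x fun _ => x₀) b =
      Fintype.linearCombination R x (b ∘ Sum.inl) + b (Sum.inr ()) • x₀ := by
    intro b
    rw [linearCombination_sumElim]
    rw [Fintype.linearCombination_apply R (fun _ : Unit => x₀)]
    simp
  refine ⟨ι ⊕ Unit, inferInstance, Sum.elim d fun _ => a, Sum.elim x fun _ => x₀, ?_, ?_, ?_,
    fun n => HasBoundedRes.ext (g := LinearMap.funLeft R R Sum.inr) ?_ (hk n)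
      ((hkos.hasBoundedRes n a).mono (by omega))⟩
  · rintro (v | v)
    · exact hd v
    · exact ha
  · rintro (v | v)
    · exact hx v
    · exact hx₀
  · rw [Set.Sum.elim_range, Submodule.span_union, Set.range_const]
  · constructor
    · intro u hu
      rw [LinearMap.mem_ker] at hu
      rw [LinearMap.mem_ker, hlin]
      simp [hu]
    · intro u _
      ext v
      simp [LinearMap.funLeft_apply]
    · intro b hb h0
      have h0' : b ∘ Sum.inr = 0 := h0
      have h1 : b (Sum.inr ()) = 0 := congrFun h0' ()
      rw [LinearMap.mem_ker, hlin, h1, zero_smul, add_zero] at hb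
      refine ⟨b ∘ Sum.inl, hb, ?_⟩
      rw [← h0']
      exact Sum.elim_comp_inl_inr b
    · intro b hb
      rw [LinearMap.mem_ker, hlin] at hb
      refine (hm _).1 ?_
      rw [LinearMap.proj_apply, LinearMap.funLeft_apply, eq_neg_of_add_eq_zero_right hb]
      exact neg_mem (linearCombination_mem_span x _)
    · intro j w hw hwj
      have h1 : w () • x₀ ∈ Submodule.span R (Set.range x) := (hm _).2 hw
      have h2 : w () • x₀ ∈ ℳ j := by simpa using hℳ.smul_mem (hwj ()) hx₀
      obtain ⟨u, huj, hu⟩ := exists_homog_of_mem_span hℳ hx h2 h1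
      refine ⟨Sum.elim (-u) w, ?_, sumElim_mem_homog (neg_mem huj) hwj,
        Sum.elim_comp_inr (-u) w⟩
      rw [LinearMap.mem_ker, hlin]
      simp [hu]

/-- The submodule generated by the components of degree at least `a`. -/
def truncGE (R : Type*) [CommRing R] {M : Type*} [AddCommGroup M] [Module R M]
    (ℳ : ℤ → AddSubgroup M) (a : ℤ) : Submodule R M :=
  Submodule.span R (⋃ b ∈ {b : ℤ | a ≤ b}, (ℳ b : Set M))

omit [GradedAlgebra 𝒜] in
theorem mem_truncGE {a b : ℤ} (hab : a ≤ b) {x : M} (hx : x ∈ ℳ b) : x ∈ truncGE R ℳ a :=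
  Submodule.subset_span (Set.mem_biUnion (show b ∈ {b : ℤ | a ≤ b} from hab) hx)

omit [GradedAlgebra 𝒜] in
theorem truncGE_le {a : ℤ} {N : Submodule R M} (h : ∀ b, a ≤ b → ∀ x ∈ ℳ b, x ∈ N) :
    truncGE R ℳ a ≤ N :=
  Submodule.span_le.2 (Set.iUnion₂_subset fun b hb x hx => h b hb x hx)

theorem eq_zero_of_mem_truncGE (hstd : IsStdGraded 𝒜) (hℳ : IsGradedFamily 𝒜 ℳ) {a c : ℤ}
    (hca : c < a) {x : M} (hx : x ∈ truncGE R ℳ a) (hxc : x ∈ ℳ c) : x = 0 := by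
  obtain ⟨p, hp, hp'⟩ := hℳ.exists_proj c
  rw [← hp x hxc]
  clear hxc
  refine Submodule.closure_induction (p := fun x _ => p x = 0) (map_zero p) ?_ ?_ hx
  · intro x y _ _ h1 h2
    rw [map_add, h1, h2, add_zero]
  · intro r y hy
    obtain ⟨b, hb, hyb⟩ := Set.mem_iUnion₂.1 hy
    rw [proj_smul hℳ hp hp' hyb]
    have hb' : a ≤ b := hb
    have h0 := ringComp_mem (𝒜 := 𝒜) (c - b) r
    rw [hstd.1 _ (by omega), Submodule.mem_bot] at h0
    rw [h0, zero_smul]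

omit [GradedAlgebra 𝒜] in
theorem mIdealG_smul_mem_truncGE (hstd : IsStdGraded 𝒜) (hℳ : IsGradedFamily 𝒜 ℳ) {a : ℤ} {x : M}
    (hx : x ∈ ℳ a) {r : R} (hr : r ∈ mIdealG 𝒜) : r • x ∈ truncGE R ℳ (a + 1) := by
  have hle : mIdealG 𝒜 ≤ Submodule.comap (LinearMap.toSpanSingleton R M x)
      (truncGE R ℳ (a + 1)) := by
    refine Submodule.span_le.2 (Set.iUnion_subset ?_)
    rintro ⟨i, hi⟩ t ht
    change t • x ∈ truncGE R ℳ (a + 1)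
    rcases lt_or_gt_of_ne hi with hi | hi
    · have h0 : t ∈ 𝒜 i := ht
      rw [hstd.1 i hi, Submodule.mem_bot] at h0
      rw [h0, zero_smul]
      exact zero_mem _
    · exact mem_truncGE (b := i + a) (by omega) (hℳ.smul_mem ht hx)
  exact hle hr

omit [GradedAlgebra 𝒜] in
theorem IsStdGraded.le_mul (hstd : IsStdGraded 𝒜) (m n : ℕ) :
    𝒜 ((m : ℤ) + n) ≤ 𝒜 m * 𝒜 n := by
  induction m with
  | zero => simp [hstd.2.1]
  | succ m ih =>
    have h1 := hstd.2.2 (m + n)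
    have h2 := hstd.2.2 m
    push_cast at h1 ⊢
    rw [show (m : ℤ) + 1 + n = m + n + 1 by ring, h1, h2, mul_assoc]
    exact mul_le_mul_right ih _

theorem truncGE_eq_span (hstd : IsStdGraded 𝒜) (hℳ : IsGradedFamily 𝒜 ℳ) {d : ℤ}
    (hgen : (⊤ : Submodule R M) ≤
      Submodule.span R (⋃ a ∈ {a : ℤ | a ≤ d}, (ℳ a : Set M))) :
    truncGE R ℳ d = Submodule.span R (ℳ d : Set M) := by
  refine le_antisymm (truncGE_le fun b hb x hx => ?_) (Submodule.span_le.2 fun x hx =>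
    mem_truncGE le_rfl hx)
  obtain ⟨p, hp, hp'⟩ := hℳ.exists_proj b
  rw [← hp x hx]
  refine Submodule.closure_induction (p := fun x _ => p x ∈ Submodule.span R (ℳ d : Set M))
    ?_ ?_ ?_ (hgen (Submodule.mem_top (x := x)))
  · rw [map_zero]
    exact zero_mem _
  · intro y z _ _ h1 h2
    rw [map_add]
    exact add_mem h1 h2
  · intro r y hy
    obtain ⟨c, hc, hyc⟩ := Set.mem_iUnion₂.1 hy
    have hc' : c ≤ d := hc
    rw [proj_smul hℳ hp hp' hyc]
    have hr := ringComp_mem (𝒜 := 𝒜) (b - c) r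
    have hmul := hstd.le_mul (b - d).toNat (d - c).toNat
    rw [Int.toNat_of_nonneg (by omega), Int.toNat_of_nonneg (by omega),
      show b - d + (d - c) = b - c by ring] at hmul
    refine Submodule.mul_induction_on (C := fun t => t • y ∈ Submodule.span R (ℳ d : Set M))
      (hmul hr) ?_ ?_
    · intro t _ q hq
      rw [mul_smul]
      refine Submodule.smul_mem _ _ (Submodule.subset_span ?_)
      simpa using hℳ.smul_mem hq hyc
    · intro t q ht hq
      rw [add_smul]
      exact add_mem ht hq

theorem hasBoundedCover_truncGE (hstd : IsStdGraded 𝒜) (hkos : Koszul 𝒜)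
    (hℳ : IsGradedFamily 𝒜 ℳ) {d r : ℤ}
    (hgen : (⊤ : Submodule R M) ≤
      Submodule.span R (⋃ a ∈ {a : ℤ | a ≤ d}, (ℳ a : Set M)))
    (hcreg : ∀ a : ℤ, HasBoundedCover 𝒜 ℳ (Submodule.span R (ℳ a : Set M)) (a + r)) (n : ℕ) :
    HasBoundedCover 𝒜 ℳ (truncGE R ℳ (d - n)) (d + r) := by
  classical
  induction n with
  | zero =>
    simpa [truncGE_eq_span hstd hℳ hgen] using hcreg d
  | succ n ih =>
    set a : ℤ := d - (n + 1 : ℕ) with ha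
    have han : d - (n : ℤ) = a + 1 := by
      rw [ha]
      push_cast
      ring
    rw [han] at ih
    obtain ⟨ι, _, e, y, he, hy, hspan, -⟩ := hcreg a
    have hyspan : ∀ v, y v ∈ truncGE R ℳ a := fun v => by
      have h1 : y v ∈ Submodule.span R (ℳ a : Set M) := hspan ▸ Submodule.subset_span ⟨v, rfl⟩
      exact Submodule.span_le.2 (fun x hx => mem_truncGE le_rfl hx) h1
    have hlow : ∀ v, e v < a → y v = 0 := fun v hv =>
      eq_zero_of_mem_truncGE hstd hℳ hv (hyspan v) (hy v)
    have hfin : ∀ T : Finset ι, HasBoundedCover 𝒜 ℳ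
        (truncGE R ℳ (a + 1) ⊔ Submodule.span R (y '' T)) (d + r) := by
      intro T
      induction T using Finset.induction_on with
      | empty => simpa using ih
      | insert v T _ hT =>
        rw [Finset.coe_insert, Set.image_insert_eq, Submodule.span_insert,
          sup_comm (Submodule.span R {y v}), ← sup_assoc]
        by_cases hv : y v ∈ truncGE R ℳ (a + 1) ⊔ Submodule.span R (y '' T)
        · rwa [sup_eq_left.2 ((Submodule.span_singleton_le_iff_mem _ _).2 hv)]
        have hev : e v = a := by
          rcases lt_trichotomy (e v) a with h | h | h
          · exact absurd (hlow v h ▸ zero_mem _) hv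
          · exact h
          · exact absurd (Submodule.mem_sup_left (mem_truncGE (by omega) (hy v))) hv
        have hya : y v ∈ ℳ a := hev ▸ hy v
        have hear := he v
        refine hT.sup_span hℳ hkos hya (by omega) fun t => ⟨fun ht => ?_, fun ht =>
          Submodule.mem_sup_left (mIdealG_smul_mem_truncGE hstd hℳ hya ht)⟩
        by_contra htm
        obtain ⟨c, hc, hct⟩ := exists_ringComp_zero_eq hstd htm
        refine hv (mem_of_algebraMap_smul_mem hc ?_)
        have h1 := Submodule.mem_sup_left (T := Submodule.span R (y '' T))
          (mIdealG_smul_mem_truncGE hstd hℳ hya (sub_ringComp_zero_mem (𝒜 := 𝒜) t))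
        have h2 := sub_mem ht h1
        rwa [← sub_smul, sub_sub_cancel, hct] at h2
    have := hfin Finset.univ
    rw [Finset.coe_univ, Set.image_univ, hspan] at this
    convert this using 1
    refine le_antisymm (truncGE_le fun b hb x hx => ?_) (sup_le ?_ ?_)
    · rcases hb.eq_or_lt with rfl | hb
      · exact Submodule.mem_sup_right (Submodule.subset_span hx)
      · exact Submodule.mem_sup_left (mem_truncGE (by omega) hx)
    · exact truncGE_le fun b hb x hx => mem_truncGE (by omega) hx
    · exact Submodule.span_le.2 fun x hx => mem_truncGE le_rfl hx

theorem exists_truncGE_eq_top [Module.Finite R M] {d : ℤ}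
    (hgen : (⊤ : Submodule R M) ≤
      Submodule.span R (⋃ a ∈ {a : ℤ | a ≤ d}, (ℳ a : Set M))) :
    ∃ n : ℕ, truncGE R ℳ (d - n) = ⊤ := by
  let F : ℕ →o Submodule R M :=
    ⟨fun n => truncGE R ℳ (d - n), fun m n hmn => truncGE_le fun b hb x hx =>
      mem_truncGE (by omega) hx⟩
  have htop : iSup F = ⊤ := by
    refine top_le_iff.1 (hgen.trans (Submodule.span_le.2 (Set.iUnion₂_subset fun a ha x hx => ?_)))
    have ha' : a ≤ d := ha
    exact Submodule.mem_iSup_of_mem (p := F) (d - a).toNat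
      (mem_truncGE (b := a) (by omega) hx)
  obtain ⟨n, hn⟩ := (Module.Finite.fg_top (R := R) (M := M)).stabilizes_of_iSup_eq F htop
  exact ⟨n, hn.symm⟩

omit [GradedAlgebra 𝒜] in
theorem isGradedFamily_of_isInternal [Module K M] [IsScalarTower K R M] {𝒩 : ℤ → Submodule K M}
    (hint : DirectSum.IsInternal 𝒩)
    (hcomp : ∀ (i j : ℤ), ∀ r ∈ 𝒜 i, ∀ x ∈ 𝒩 j, r • x ∈ 𝒩 (i + j)) :
    IsGradedFamily 𝒜 fun j => (𝒩 j).toAddSubgroup where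
  smul_mem hr hx := hcomp _ _ _ hr _ hx
  exists_proj j := by
    let _ := hint.chooseDecomposition
    refine ⟨{ toFun := fun x => (decompose 𝒩 x j : M)
              map_zero' := by simp
              map_add' := fun x y => by simp [decompose_add] }, ?_, ?_⟩
    · intro x hx
      exact decompose_of_mem_same 𝒩 hx
    · intro i hij x hx
      exact decompose_of_mem_ne 𝒩 hx hij

end MaximalIdeal

end Regularity

/-- Over a Koszul standard graded `K`-algebra `R`, a finitely
generated graded module `M` generated in degrees `≤ d` satisfies
`reg_R(M) ≤ d + creg(M)`: if `M` is `r`-componentwise regular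
(`reg M_{⟨a⟩} ≤ a + r` for all `a`), then `reg M ≤ d + r`. -/
theorem reg_le_gendeg_add_creg
    {K : Type*} [Field K] {R : Type*} [CommRing R] [Algebra K R]
    (𝒜 : ℤ → Submodule K R) [GradedAlgebra 𝒜]
    (hstd : IsStdGraded 𝒜) (hkos : Koszul 𝒜)
    {M : Type*} [AddCommGroup M] [Module R M] [Module K M] [IsScalarTower K R M]
    [Module.Finite R M]
    (ℳ : ℤ → Submodule K M) (hint : DirectSum.IsInternal ℳ)
    (hcomp : ∀ (i j : ℤ), ∀ r ∈ 𝒜 i, ∀ x ∈ ℳ j, r • x ∈ ℳ (i + j))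
    (d : ℤ)
    (hgen : (⊤ : Submodule R M) ≤
      Submodule.span R (⋃ a ∈ {a : ℤ | a ≤ d}, (ℳ a : Set M)))
    (r : ℤ) (hcreg : ∀ a : ℤ, GRegLE 𝒜 ℳ (gcomp ℳ a) (a + r)) :
    GRegLE 𝒜 ℳ (⊤ : Submodule R M) (d + r) := by
  have hℳ := isGradedFamily_of_isInternal hint hcomp
  obtain ⟨n, hn⟩ := exists_truncGE_eq_top (ℳ := fun j => (ℳ j).toAddSubgroup) hgen
  have := hasBoundedCover_truncGE hstd hkos hℳ hgen (fun a => (hcreg a).hasBoundedCover) n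
  rw [hn] at this
  exact this.gregLE hstd hℳ

end CregPaperG
end
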